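/- arXiv:2412.09532 — 4 statements merged into one kernel-verified Lean document; each statement's English description precedes it below -/
import Mathlib

section
/- Let d ≥ 1 and let μ be a probability measure on {0,1}^{Z^d} invariant under all translations θ_z, z ∈ Z^d. Suppose there exist integers L ≥ 1 and ℓ ≥ 6 such that, setting L_N = L·ℓ^N, one has μ({ξ : B(L_N − 2) ↔*ξ B(2L_N)^c}) ≤ 2^{−2^N} for every N ∈ ℕ. Then μ(Perc) = 0. -/
open MeasureTheory

namespace VoterPerc

abbrev Site (d : ℕ) := Fin d → ℤ
abbrev Config (d : ℕ) := Site d → Bool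

/-- ℓ∞ distance between two sites. -/
def dinf {d : ℕ} (x y : Site d) : ℕ := Finset.univ.sup fun i => (x i - y i).natAbs

/-- ℓ¹ distance between two sites. -/
def d1 {d : ℕ} (x y : Site d) : ℕ := ∑ i, (x i - y i).natAbs

/-- The ℓ∞ ball of (integer) radius `r` centred at `c`. -/
def ball {d : ℕ} (c : Site d) (r : ℤ) : Set (Site d) := {y | (dinf y c : ℤ) ≤ r}

/-- Translation of configurations: `(translate z ξ) y = ξ (y - z)`. -/
def translate {d : ℕ} (z : Site d) (ξ : Config d) : Config d := fun y => ξ (y - z)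

/-- The percolation event: there is an infinite nearest-neighbour path of distinct open sites. -/
def Perc (d : ℕ) : Set (Config d) :=
  {ξ | ∃ γ : ℕ → Site d, Function.Injective γ ∧
    (∀ n, d1 (γ n) (γ (n + 1)) = 1) ∧ (∀ n, ξ (γ n) = true)}

/-- `StarCross ξ A B`: there is a finite `*`-connected path of `ξ`-open sites from a
`*`-neighbour of a point of `A` to a `*`-neighbour of a point of `B`. -/
def StarCross {d : ℕ} (ξ : Config d) (A B : Set (Site d)) : Prop :=
  ∃ (n : ℕ) (γ : ℕ → Site d),
    (∃ a ∈ A, dinf (γ 0) a = 1) ∧ (∃ b ∈ B, dinf (γ n) b = 1) ∧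
    (∀ i < n, dinf (γ i) (γ (i + 1)) = 1) ∧ (∀ i ≤ n, ξ (γ i) = true)

theorem aux_dinf_le {d : ℕ} (x y : Site d) (k : ℕ) :
    dinf x y ≤ k ↔ ∀ i, (x i - y i).natAbs ≤ k := by
  simp [dinf, Finset.sup_le_iff]

theorem aux_dinf_one {d : ℕ} (hd : 1 ≤ d) (x : Site d) : dinf x (x + 1) = 1 := by
  apply le_antisymm
  · rw [aux_dinf_le]; intro i; simp
  · have h := (aux_dinf_le x (x + 1) (dinf x (x + 1))).1 le_rfl ⟨0, hd⟩
    simpa using h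

theorem aux_dinf_add {d : ℕ} (x : Site d) : dinf (x + 1) 0 ≤ dinf x 0 + 1 := by
  rw [aux_dinf_le]
  intro i
  have h := (aux_dinf_le x 0 (dinf x 0)).1 le_rfl i
  simp only [Pi.add_apply, Pi.one_apply, Pi.zero_apply] at *
  omega

theorem aux_dinf_add' {d : ℕ} (x : Site d) : dinf x 0 ≤ dinf (x + 1) 0 + 1 := by
  rw [aux_dinf_le]
  intro i
  have h := (aux_dinf_le (x + 1) 0 (dinf (x + 1) 0)).1 le_rfl i
  simp only [Pi.add_apply, Pi.one_apply, Pi.zero_apply] at *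
  omega

theorem aux_d1 {d : ℕ} (x y : Site d) (h : d1 x y = 1) : dinf x y = 1 := by
  apply le_antisymm
  · rw [aux_dinf_le]; intro i
    rw [← h]
    exact Finset.single_le_sum (f := fun i => (x i - y i).natAbs) (fun _ _ => Nat.zero_le _)
      (Finset.mem_univ i)
  · by_contra hlt
    have h0 := (aux_dinf_le x y 0).1 (by omega)
    have : d1 x y = 0 := Finset.sum_eq_zero fun i _ => Nat.le_zero.1 (h0 i)
    omega

theorem aux_far {d : ℕ} (γ : ℕ → Site d) (hγ : Function.Injective γ) (R : ℕ) :
    ∃ n, R < dinf (γ n) 0 := by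
  by_contra! hc
  have hfin : (Set.Icc (fun _ => -(R : ℤ)) (fun _ => (R : ℤ)) : Set (Site d)).Finite :=
    Set.finite_Icc _ _
  refine Set.infinite_range_of_injective hγ (hfin.subset ?_)
  rintro _ ⟨n, rfl⟩
  have h := (aux_dinf_le _ _ _).1 (hc n)
  simp only [Pi.zero_apply] at h
  constructor <;> intro i <;> have := h i <;> dsimp only <;> omega

/-- If a translation-invariant probability measure `μ` on `{0,1}^{ℤ^d}`
satisfies, for some scales `L_N = L·ℓ^N` with `L ≥ 1`, `ℓ ≥ 6`, the bound
`μ(B(L_N − 2) ↔*ξ B(2L_N)ᶜ) ≤ 2^{−2^N}` for every `N ∈ ℕ`, then `μ(Perc) = 0`. -/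
theorem no_percolation_of_crossing_decay (d : ℕ) (hd : 1 ≤ d)
    (μ : Measure (Config d)) [IsProbabilityMeasure μ]
    (hinv : ∀ z : Site d, μ.map (translate z) = μ)
    (L ℓ : ℕ) (hL : 1 ≤ L) (hℓ : 6 ≤ ℓ)
    (hbound : ∀ N : ℕ, 1 ≤ N →
      μ {ξ : Config d | StarCross ξ (ball (0 : Site d) ((L * ℓ ^ N : ℕ) - 2))
          ((ball (0 : Site d) (2 * (L * ℓ ^ N : ℕ)))ᶜ)} ≤ 1 / 2 ^ 2 ^ N) :
    μ (Perc d) = 0 := by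
  have hsub : Perc d ⊆ ⋃ x : Site d, {ξ | ∃ γ : ℕ → Site d, Function.Injective γ ∧
      (∀ n, d1 (γ n) (γ (n + 1)) = 1) ∧ (∀ n, ξ (γ n) = true) ∧ γ 0 = x} := by
    rintro ξ ⟨γ, h1, h2, h3⟩
    exact Set.mem_iUnion.2 ⟨γ 0, γ, h1, h2, h3, rfl⟩
  refine measure_mono_null hsub (measure_iUnion_null fun x => ?_)
  have hle : ∀ N : ℕ, dinf x 0 + 3 ≤ N → μ {ξ : Config d | ∃ γ : ℕ → Site d,
      Function.Injective γ ∧ (∀ n, d1 (γ n) (γ (n + 1)) = 1) ∧ (∀ n, ξ (γ n) = true) ∧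
        γ 0 = x} ≤ 1 / 2 ^ 2 ^ N := by
    intro N hN
    refine (measure_mono ?_).trans (hbound N (by omega))
    rintro ξ ⟨γ, h1, h2, h3, rfl⟩
    have hbig : N ≤ L * ℓ ^ N :=
      (Nat.lt_pow_self (by omega : 1 < ℓ)).le.trans (Nat.le_mul_of_pos_left _ hL)
    generalize L * ℓ ^ N = M at hbig ⊢
    obtain ⟨n, hn⟩ := aux_far γ h1 (2 * M + 1)
    refine ⟨n, γ, ⟨γ 0 + 1, ?_, aux_dinf_one hd _⟩, ⟨γ n + 1, ?_, aux_dinf_one hd _⟩,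
      fun i _ => aux_d1 _ _ (h2 i), fun i _ => h3 i⟩
    · have := aux_dinf_add (γ 0)
      simp only [ball, Set.mem_ofPred_eq]
      omega
    · have := aux_dinf_add' (γ n)
      simp only [ball, Set.mem_compl_iff, Set.mem_ofPred_eq]
      omega
  have hlim : Filter.Tendsto (fun N : ℕ => (1 / 2 ^ 2 ^ N : ENNReal)) Filter.atTop (nhds 0) := by
    have h1 : Filter.Tendsto (fun n : ℕ => ((2 : ENNReal)⁻¹) ^ n) Filter.atTop (nhds 0) :=
      ENNReal.tendsto_pow_atTop_nhds_zero_of_lt_one (by simp)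
    have h2 := h1.comp (tendsto_pow_atTop_atTop_of_one_lt (by norm_num : 1 < (2 : ℕ)))
    refine h2.congr fun N => ?_
    simp [ENNReal.inv_pow]
  refine le_antisymm (ge_of_tendsto hlim ?_) zero_le
  filter_upwards [Filter.eventually_ge_atTop (dinf x 0 + 3)] with N hN using hle N hN

end VoterPerc
end

section
/- For every d ≥ 1 there exists a constant C_d > 0 (depending only on d) such that for all integers L ≥ 1, ℓ ≥ 6 and N ≥ 1, the number of proper embeddings satisfies |P_N| ≤ (C_d·ℓ^{2d−2})^{2^N}. -/
open MeasureTheory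

namespace VoterPerc

/-- The binary tree `T_N` of height `N`: words on `{1,2}` (modelled as `Fin 2`)
of length at most `N`. -/
abbrev TN (N : ℕ) := {m : List (Fin 2) // m.length ≤ N}

/-- The child `m_j` of a node `m` of level `< N`. -/
def child {N : ℕ} (m : TN N) (h : m.1.length < N) (j : Fin 2) : TN N :=
  ⟨m.1 ++ [j], by simp only [List.length_append, List.length_cons, List.length_nil]; omega⟩

/-- `𝒯 : T_N → ℤ^d` is a proper embedding (for scales `L_N = L·ℓ^N`) if the root is sent
to the origin, every node of level `k` lands in `L_{N−k}·ℤ^d`, and the two children of any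
node `m` of level `k < N` are at ℓ∞-distance `L_{N−k}` resp. `2·L_{N−k}` from `𝒯 m`. -/
def ProperEmbedding (d L ℓ N : ℕ) (𝒯 : TN N → Site d) : Prop :=
  (∀ m : TN N, m.1 = [] → 𝒯 m = 0) ∧
  (∀ m : TN N, ∃ z : Site d,
      𝒯 m = fun i => ((L * ℓ ^ (N - m.1.length) : ℕ) : ℤ) * z i) ∧
  (∀ (m : TN N) (h : m.1.length < N),
      dinf (𝒯 (child m h 0)) (𝒯 m) = L * ℓ ^ (N - m.1.length) ∧
      dinf (𝒯 (child m h 1)) (𝒯 m) = 2 * (L * ℓ ^ (N - m.1.length)))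

/-- The leaves of `T_N`: words of length exactly `N`. -/
def IsLeaf {N : ℕ} (m : TN N) : Prop := m.1.length = N

/-- Sites of sup norm exactly `r`, covered by faces of a cube. -/
noncomputable def sphereCover (d r : ℕ) : Finset (Site d) :=
  Finset.univ.biUnion fun i : Fin d =>
    Fintype.piFinset fun j => if j = i then {(r : ℤ), -(r : ℤ)} else Finset.Icc (-(r : ℤ)) r

lemma card_sphereCover_le (d r : ℕ) : (sphereCover d r).card ≤ d * (2 * (2 * r + 1) ^ (d - 1)) := by
  refine Finset.card_biUnion_le.trans ?_
  have h : ∀ i ∈ (Finset.univ : Finset (Fin d)), (Fintype.piFinset fun j : Fin d =>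
      if j = i then {(r : ℤ), -(r : ℤ)} else Finset.Icc (-(r : ℤ)) r).card
        ≤ 2 * (2 * r + 1) ^ (d - 1) := by
    intro i _
    rw [Fintype.card_piFinset, ← Finset.mul_prod_erase _ _ (Finset.mem_univ i)]
    refine Nat.mul_le_mul ?_ ?_
    · simp only [if_true]
      exact Finset.card_le_two
    · have : ∀ j ∈ Finset.univ.erase i, (if j = i then ({(r : ℤ), -(r : ℤ)} : Finset ℤ)
          else Finset.Icc (-(r : ℤ)) r).card ≤ 2 * r + 1 := by
        intro j hj
        rw [if_neg (Finset.ne_of_mem_erase hj), Int.card_Icc]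
        omega
      refine (Finset.prod_le_pow_card _ _ _ this).trans ?_
      simp
  refine (Finset.sum_le_card_nsmul _ _ _ h).trans ?_
  simp

lemma mem_sphereCover {d r : ℕ} (hd : 1 ≤ d) (z : Site d)
    (h : (Finset.univ.sup fun i => (z i).natAbs) = r) : z ∈ sphereCover d r := by
  have hne : (Finset.univ : Finset (Fin d)).Nonempty := ⟨⟨0, hd⟩, Finset.mem_univ _⟩
  obtain ⟨i, _, hi⟩ := Finset.exists_mem_eq_sup _ hne (fun i => (z i).natAbs)
  rw [h] at hi
  simp only [sphereCover, Finset.mem_biUnion, Finset.mem_univ, true_and, Fintype.mem_piFinset]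
  refine ⟨i, fun j => ?_⟩
  have hj : (z j).natAbs ≤ r := by
    rw [← h]
    exact Finset.le_sup (f := fun i => (z i).natAbs) (Finset.mem_univ j)
  split_ifs with hji
  · subst hji
    simp only [Finset.mem_insert, Finset.mem_singleton]
    omega
  · rw [Finset.mem_Icc]
    omega

lemma sup_mul_natAbs {d K r : ℕ} (hK : 0 < K) (w : Site d)
    (h : (Finset.univ.sup fun i => ((K : ℤ) * w i).natAbs) = r * K) :
    (Finset.univ.sup fun i => (w i).natAbs) = r := by
  have e : (Finset.univ.sup fun i => ((K : ℤ) * w i).natAbs)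
      = K * (Finset.univ.sup fun i => (w i).natAbs) := by
    apply le_antisymm
    · refine Finset.sup_le fun i hi => ?_
      rw [Int.natAbs_mul, Int.natAbs_natCast]
      exact Nat.mul_le_mul le_rfl (Finset.le_sup (f := fun i => (w i).natAbs) hi)
    · rw [mul_comm, ← Nat.le_div_iff_mul_le hK]
      refine Finset.sup_le fun i hi => ?_
      rw [Nat.le_div_iff_mul_le hK, mul_comm]
      have := Finset.le_sup (f := fun i => ((K : ℤ) * w i).natAbs) hi
      rwa [Int.natAbs_mul, Int.natAbs_natCast] at this
  rw [e, mul_comm] at h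
  exact Nat.eq_of_mul_eq_mul_right hK h

/-- Internal nodes. -/
abbrev Inner (N : ℕ) := {m : List (Fin 2) // m.length < N}

/-- The map of an internal node to the corresponding length-indexed word. -/
def Inner.toSigma {N : ℕ} (m : Inner N) : Σ k : Fin N, List.Vector (Fin 2) k :=
  ⟨⟨m.1.length, m.2⟩, ⟨m.1, rfl⟩⟩

lemma Inner.toSigma_injective (N : ℕ) : Function.Injective (Inner.toSigma (N := N)) := by
  intro a b h
  have := congrArg (fun s : Σ k : Fin N, List.Vector (Fin 2) k => s.2.1) h
  exact Subtype.ext this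

lemma finite_inner (N : ℕ) : Finite (Inner N) :=
  Finite.of_injective _ (Inner.toSigma_injective N)

lemma card_inner_le (N : ℕ) : Nat.card (Inner N) ≤ 2 ^ N := by
  refine (Nat.card_le_card_of_injective _ (Inner.toSigma_injective N)).trans ?_
  rw [Nat.card_eq_fintype_card, Fintype.card_sigma]
  simp only [card_vector, Fintype.card_fin]
  rw [Fin.sum_univ_eq_sum_range (fun k => 2 ^ k)]
  exact (Nat.geomSum_lt (le_refl 2) (by simp)).le

/-- The rescaled displacement. -/
def disp {d N : ℕ} (L ℓ : ℕ) (T : TN N → Site d) (j : Fin 2) (m : Inner N) : Site d := fun i =>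
  (T (child ⟨m.1, m.2.le⟩ m.2 j) i - T ⟨m.1, m.2.le⟩ i) / ((L * ℓ ^ (N - m.1.length - 1) : ℕ) : ℤ)

lemma disp_spec {d N L ℓ : ℕ} {T : TN N → Site d} (hT : ProperEmbedding d L ℓ N T)
    (j : Fin 2) (m : Inner N) (i : Fin d) :
    T (child ⟨m.1, m.2.le⟩ m.2 j) i - T ⟨m.1, m.2.le⟩ i
      = ((L * ℓ ^ (N - m.1.length - 1) : ℕ) : ℤ) * disp L ℓ T j m i := by
  obtain ⟨z, hz⟩ := hT.2.1 (child ⟨m.1, m.2.le⟩ m.2 j)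
  obtain ⟨y, hy⟩ := hT.2.1 ⟨m.1, m.2.le⟩
  unfold disp
  rw [Int.mul_ediv_cancel']
  have hm := m.2
  have e1 : N - (child ⟨m.1, m.2.le⟩ m.2 j).1.length = N - m.1.length - 1 := by
    simp [child]
    omega
  have e2 : N - m.1.length = (N - m.1.length - 1) + 1 := by omega
  rw [e1] at hz
  rw [hz, hy]
  apply dvd_sub
  · exact dvd_mul_right _ _
  · apply Dvd.dvd.mul_right
    rw [Int.natCast_dvd_natCast]
    exact Nat.mul_dvd_mul_left _ (pow_dvd_pow _ (by simp))

lemma disp_mem {d N L ℓ : ℕ} (hd : 1 ≤ d) (hL : 1 ≤ L) (hl : 6 ≤ ℓ) {T : TN N → Site d}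
    (hT : ProperEmbedding d L ℓ N T) (m : Inner N) :
    disp L ℓ T 0 m ∈ sphereCover d ℓ ∧ disp L ℓ T 1 m ∈ sphereCover d (2 * ℓ) := by
  have hK : 0 < L * ℓ ^ (N - m.1.length - 1) := by positivity
  have hm := m.2
  have e2 : L * ℓ ^ (N - m.1.length) = ℓ * (L * ℓ ^ (N - m.1.length - 1)) := by
    obtain ⟨k, hk⟩ : ∃ k, N - m.1.length = k + 1 := ⟨N - m.1.length - 1, by omega⟩
    rw [hk, Nat.add_sub_cancel]
    ring
  obtain ⟨h0, h1⟩ := hT.2.2 ⟨m.1, m.2.le⟩ m.2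
  simp only [dinf, disp_spec hT] at h0 h1
  constructor
  · exact mem_sphereCover hd _ (sup_mul_natAbs hK _ (h0.trans e2))
  · exact mem_sphereCover hd _ (sup_mul_natAbs hK _ (h1.trans (by rw [e2, mul_assoc])))

lemma eq_of_disp {d N L ℓ : ℕ} {T T' : TN N → Site d} (hT : ProperEmbedding d L ℓ N T)
    (hT' : ProperEmbedding d L ℓ N T')
    (h : ∀ j m, disp L ℓ T j m = disp L ℓ T' j m) : T = T' := by
  have key : ∀ (m : List (Fin 2)) (hm : m.length ≤ N), T ⟨m, hm⟩ = T' ⟨m, hm⟩ := by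
    intro m
    induction m using List.reverseRecOn with
    | nil => intro hm; rw [hT.1 _ rfl, hT'.1 _ rfl]
    | append_singleton m j ih =>
      intro hm
      have hm' : m.length < N := by simp at hm; omega
      funext i
      have a := disp_spec hT j ⟨m, hm'⟩ i
      have b := disp_spec hT' j ⟨m, hm'⟩ i
      rw [h, ← b, ih hm'.le] at a
      exact sub_left_injective a
  funext m
  exact key m.1 m.2

/-- There is a constant `C_d > 0`, depending only on the dimension, such
that for all `L ≥ 1`, `ℓ ≥ 6`, `N ≥ 1`, the set of proper embeddings of `T_N` is finite
and has at most `(C_d·ℓ^{2d−2})^{2^N}` elements. -/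
theorem card_properEmbeddings_le (d : ℕ) (hd : 1 ≤ d) :
    ∃ C : ℝ, 0 < C ∧ ∀ L ℓ N : ℕ, 1 ≤ L → 6 ≤ ℓ → 1 ≤ N →
      Finite {𝒯 : TN N → Site d // ProperEmbedding d L ℓ N 𝒯} ∧
      (Nat.card {𝒯 : TN N → Site d // ProperEmbedding d L ℓ N 𝒯} : ℝ) ≤
        (C * (ℓ : ℝ) ^ (2 * d - 2)) ^ 2 ^ N := by
  refine ⟨(((2 * d) * 5 ^ (d - 1)) ^ 2 : ℕ), by positivity, ?_⟩
  intro L ℓ N hL hl hN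
  have := finite_inner N
  let A := {x // x ∈ sphereCover d ℓ}
  let B := {x // x ∈ sphereCover d (2 * ℓ)}
  have : Finite A := inferInstanceAs (Finite {x // x ∈ sphereCover d ℓ})
  have : Finite B := inferInstanceAs (Finite {x // x ∈ sphereCover d (2 * ℓ)})
  let Φ : {𝒯 : TN N → Site d // ProperEmbedding d L ℓ N 𝒯} → (Inner N → A × B) := fun T m =>
    (⟨disp L ℓ T.1 0 m, (disp_mem hd hL hl T.2 m).1⟩,
      ⟨disp L ℓ T.1 1 m, (disp_mem hd hL hl T.2 m).2⟩)
  have hΦ : Function.Injective Φ := by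
    intro T T' h
    apply Subtype.ext
    refine eq_of_disp T.2 T'.2 fun j m => ?_
    have hm := congrFun h m
    simp only [Φ, Prod.mk.injEq] at hm
    fin_cases j
    · exact congrArg Subtype.val hm.1
    · exact congrArg Subtype.val hm.2
  refine ⟨Finite.of_injective Φ hΦ, ?_⟩
  have hc := Nat.card_le_card_of_injective Φ hΦ
  have hA : Nat.card A ≤ d * (2 * (5 * ℓ) ^ (d - 1)) := by
    have : Nat.card A = (sphereCover d ℓ).card := by simp [A]
    rw [this]
    refine (card_sphereCover_le d ℓ).trans ?_
    gcongr
    omega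
  have hB : Nat.card B ≤ d * (2 * (5 * ℓ) ^ (d - 1)) := by
    have : Nat.card B = (sphereCover d (2 * ℓ)).card := by simp [B]
    rw [this]
    refine (card_sphereCover_le d (2 * ℓ)).trans ?_
    gcongr
    omega
  have hAB : Nat.card (A × B) ≤ ((2 * d) * 5 ^ (d - 1)) ^ 2 * ℓ ^ (2 * d - 2) := by
    rw [Nat.card_prod]
    refine (Nat.mul_le_mul hA hB).trans (le_of_eq ?_)
    have : 2 * d - 2 = (d - 1) * 2 := by omega
    rw [this, pow_mul, mul_pow]
    ring
  have hpos : 1 ≤ ((2 * d) * 5 ^ (d - 1)) ^ 2 * ℓ ^ (2 * d - 2) :=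
    Nat.succ_le_of_lt (by positivity)
  have hfin : Nat.card {𝒯 : TN N → Site d // ProperEmbedding d L ℓ N 𝒯} ≤
      (((2 * d) * 5 ^ (d - 1)) ^ 2 * ℓ ^ (2 * d - 2)) ^ 2 ^ N := by
    refine hc.trans ?_
    rw [Nat.card_fun]
    exact (Nat.pow_le_pow_left hAB _).trans (Nat.pow_le_pow_right hpos (card_inner_le N))
  exact_mod_cast hfin


end VoterPerc
end

section
/- Assume d ≥ 3 and fix integers L ≥ 3, ℓ ≥ 6, N ≥ 1, a constant c > 0 and α̂ ∈ (0,1]. Let 𝒯 ∈ P_N be a proper embedding, Λ = ∪_{m ∈ T_(N)} B(𝒯(m), 2L), and let Λ' ⊆ Λ. Let (w_x)_{x ∈ Λ'} be points of Z^d such that |w_x − x| ≤ ℓ/4 for every x ∈ Λ' and |w_x − w_y| ≥ ℓ^{1/4} for all distinct x, y ∈ Λ'. Let h : Z^d × Z^d → [0,∞) satisfy h(u,v) ≤ c·|u−v|^{2−d} for all u ≠ v. Then the product over unordered pairs of distinct x, y ∈ Λ' of (1 + h(w_x, w_y)·(α̂^{−2} − 1)) is at most exp{ c·α̂^{−2}·(4L+1)^{2d}·2^N·ℓ^{(2−d)/4}·(1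 + 2·∑_{k ≥ 0} (2ℓ^{2−d})^k ) } (the geometric series converging since 2ℓ^{2−d} < 1). -/
open MeasureTheory

namespace VoterPerc

theorem dinf_le_iff {d : ℕ} (x y : Site d) (r : ℕ) :
    dinf x y ≤ r ↔ ∀ i, (x i - y i).natAbs ≤ r := by
  simp [dinf, Finset.sup_le_iff]

theorem dinf_self {d : ℕ} (x : Site d) : dinf x x = 0 := by
  have := (dinf_le_iff x x 0).2 (by simp)
  omega

theorem dinf_comm {d : ℕ} (x y : Site d) : dinf x y = dinf y x := by
  unfold dinf
  congr 1
  funext i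
  omega

theorem dinf_tri {d : ℕ} (x y z : Site d) : dinf x z ≤ dinf x y + dinf y z := by
  rw [dinf_le_iff]
  intro i
  have h1 := (dinf_le_iff x y _).1 le_rfl i
  have h2 := (dinf_le_iff y z _).1 le_rfl i
  omega

/-- Extension of an embedding to all lists. -/
def ext {d N : ℕ} (𝒯 : TN N → Site d) (l : List (Fin 2)) : Site d :=
  if h : l.length ≤ N then 𝒯 ⟨l, h⟩ else 0

theorem ext_child {d L ℓ N : ℕ} {𝒯 : TN N → Site d} (h𝒯 : ProperEmbedding d L ℓ N 𝒯)
    (q : List (Fin 2)) (hq : q.length < N) :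
    dinf (ext 𝒯 (q ++ [0])) (ext 𝒯 q) = L * ℓ ^ (N - q.length) ∧
    dinf (ext 𝒯 (q ++ [1])) (ext 𝒯 q) = 2 * (L * ℓ ^ (N - q.length)) := by
  have := h𝒯.2.2 ⟨q, hq.le⟩ hq
  have h1 : q.length + 1 ≤ N := hq
  simpa [ext, child, hq.le, h1] using this

theorem ext_child_le {d L ℓ N : ℕ} {𝒯 : TN N → Site d} (h𝒯 : ProperEmbedding d L ℓ N 𝒯)
    (q : List (Fin 2)) (hq : q.length < N) (s : Fin 2) :
    dinf (ext 𝒯 (q ++ [s])) (ext 𝒯 q) ≤ 2 * (L * ℓ ^ (N - q.length)) := by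
  have := ext_child h𝒯 q hq
  fin_cases s
  · simp only [Fin.zero_eta]; omega
  · simp only [Fin.mk_one]; omega

theorem ext_sep {d L ℓ N : ℕ} {𝒯 : TN N → Site d} (h𝒯 : ProperEmbedding d L ℓ N 𝒯)
    (q : List (Fin 2)) (hq : q.length < N) (s t : Fin 2) (hst : s ≠ t) :
    L * ℓ ^ (N - q.length) ≤ dinf (ext 𝒯 (q ++ [s])) (ext 𝒯 (q ++ [t])) := by
  have h := ext_child h𝒯 q hq
  have h1 := dinf_tri (ext 𝒯 (q ++ [1])) (ext 𝒯 (q ++ [0])) (ext 𝒯 q)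
  have h2 := dinf_comm (ext 𝒯 (q ++ [1])) (ext 𝒯 (q ++ [0]))
  fin_cases s <;> fin_cases t <;> simp only [Fin.zero_eta, Fin.mk_one, ne_eq, not_true] at hst ⊢
  · omega
  · omega

theorem descent {d L ℓ N : ℕ} (hℓ : 6 ≤ ℓ) {𝒯 : TN N → Site d}
    (h𝒯 : ProperEmbedding d L ℓ N 𝒯) (u : List (Fin 2)) :
    ∀ q : List (Fin 2), q.length + u.length = N →
      (ℓ - 1) * dinf (ext 𝒯 (q ++ u)) (ext 𝒯 q) + 2 * L * ℓ ≤
        2 * L * ℓ ^ (N - q.length + 1) := by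
  induction u with
  | nil =>
    intro q hq
    have : N - q.length = 0 := by simp at hq; omega
    simp [dinf_self, this]
  | cons s u ih =>
    intro q hq
    have hq' : q.length + (u.length + 1) = N := by simpa using hq
    have h1 := ih (q ++ [s]) (by simp; omega)
    have h2 := ext_child_le h𝒯 q (by omega) s
    have h3 := dinf_tri (ext 𝒯 (q ++ [s] ++ u)) (ext 𝒯 (q ++ [s])) (ext 𝒯 q)
    have e1 : N - (q ++ [s]).length + 1 = N - q.length := by simp; omega
    rw [e1] at h1
    rw [List.append_cons]
    generalize dinf (ext 𝒯 (q ++ [s] ++ u)) (ext 𝒯 (q ++ [s])) = A at *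
    generalize dinf (ext 𝒯 (q ++ [s])) (ext 𝒯 q) = B at *
    generalize dinf (ext 𝒯 (q ++ [s] ++ u)) (ext 𝒯 q) = C at *
    rw [pow_succ]
    generalize ℓ ^ (N - q.length) = P at *
    obtain ⟨r, rfl⟩ : ∃ r, ℓ = r + 1 := ⟨ℓ - 1, by omega⟩
    simp only [Nat.add_sub_cancel] at *
    nlinarith [Nat.mul_le_mul_left r h3, Nat.mul_le_mul_left r h2]

theorem split_lists : ∀ (a b : List (Fin 2)), a.length = b.length → a ≠ b →
    ∃ p s t u v, s ≠ t ∧ a = p ++ s :: u ∧ b = p ++ t :: v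
  | [], [], _, h => absurd rfl h
  | [], _ :: _, h, _ => by simp at h
  | _ :: _, [], h, _ => by simp at h
  | x :: a, y :: b, hl, hne => by
    by_cases hxy : x = y
    · subst hxy
      obtain ⟨p, s, t, u, v, h1, h2, h3⟩ := split_lists a b (by simpa using hl)
        (by simpa using hne)
      exact ⟨x :: p, s, t, u, v, h1, by simp [h2], by simp [h3]⟩
    · exact ⟨[], x, y, a, b, hxy, rfl, rfl⟩

theorem arith (L ℓ M E1 E2 q1 q2 D : ℕ) (hL : 3 ≤ L) (hℓ : 6 ≤ ℓ) (hM : 2 ≤ M)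
    (h1 : (ℓ - 1) * E1 + 2 * L * ℓ ≤ 2 * L * ℓ ^ M)
    (h2 : (ℓ - 1) * E2 + 2 * L * ℓ ≤ 2 * L * ℓ ^ M)
    (hq1 : 4 * q1 ≤ ℓ) (hq2 : 4 * q2 ≤ ℓ)
    (h : L * ℓ ^ M ≤ E1 + 2 * L + q1 + D + q2 + 2 * L + E2) : ℓ ^ M ≤ 2 * D := by
  have hP : ℓ * ℓ ≤ ℓ ^ M := by
    rw [← pow_two]; exact Nat.pow_le_pow_right (by omega) hM
  generalize ℓ ^ M = P at *
  obtain ⟨r, rfl⟩ : ∃ r, ℓ = r + 6 := ⟨ℓ - 6, by omega⟩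
  obtain ⟨K, rfl⟩ : ∃ r, L = r + 3 := ⟨L - 3, by omega⟩
  simp only [show r + 6 - 1 = r + 5 by omega] at *
  have h3 := Nat.mul_le_mul_left (r + 5) h
  have h4 := Nat.mul_le_mul_left (r + 5) hq1
  have h5 := Nat.mul_le_mul_left (r + 5) hq2
  have h6 : (r + 5) * P ≤ (r + 5) * (2 * D) := by
    zify at *
    have : (0 : ℤ) ≤ (r + 1) * K * P := by positivity
    have : (0 : ℤ) ≤ r * (P - (r + 6) * (r + 6)) := mul_nonneg (by positivity) (by linarith)
    nlinarith
  exact Nat.le_of_mul_le_mul_left h6 (by omega)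

/-- Key geometric lemma. -/
theorem geom {d L ℓ N : ℕ} (hL : 3 ≤ L) (hℓ : 6 ≤ ℓ) {𝒯 : TN N → Site d}
    (h𝒯 : ProperEmbedding d L ℓ N 𝒯) (a b : List (Fin 2)) (ha : a.length = N)
    (hb : b.length = N) (hab : a ≠ b) (x y w z : Site d)
    (hx : dinf x (ext 𝒯 a) ≤ 2 * L) (hy : dinf y (ext 𝒯 b) ≤ 2 * L)
    (hw : 4 * dinf w x ≤ ℓ) (hz : 4 * dinf z y ≤ ℓ) :
    ∃ M, 1 ≤ M ∧ M ≤ N ∧ a.take (N - M) = b.take (N - M) ∧ (2 ≤ M → ℓ ^ M ≤ 2 * dinf w z) := by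
  obtain ⟨p, s, t, u, v, hst, rfl, rfl⟩ := split_lists a b (by omega) hab
  simp at ha hb
  refine ⟨N - p.length, by omega, by omega, ?_, ?_⟩
  · rw [show N - (N - p.length) = p.length by omega]
    simp
  · intro hM
    have h0 := ext_sep h𝒯 p (by omega) s t hst
    have d1 := descent hℓ h𝒯 u (p ++ [s]) (by simp; omega)
    have d2 := descent hℓ h𝒯 v (p ++ [t]) (by simp; omega)
    have e1 : N - (p ++ [s]).length + 1 = N - p.length := by simp; omega
    have e2 : N - (p ++ [t]).length + 1 = N - p.length := by simp; omega
    rw [e1] at d1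
    rw [e2] at d2
    rw [List.append_cons] at hx hy
    refine arith L ℓ _ _ _ _ _ _ hL hℓ hM d1 d2 hw hz (h0.trans ?_)
    have t1 := dinf_tri (ext 𝒯 (p ++ [s])) (ext 𝒯 (p ++ [s] ++ u)) (ext 𝒯 (p ++ [t]))
    have t2 := dinf_tri (ext 𝒯 (p ++ [s] ++ u)) x (ext 𝒯 (p ++ [t]))
    have t3 := dinf_tri x w (ext 𝒯 (p ++ [t]))
    have t4 := dinf_tri w z (ext 𝒯 (p ++ [t]))
    have t5 := dinf_tri z y (ext 𝒯 (p ++ [t]))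
    have t6 := dinf_tri y (ext 𝒯 (p ++ [t] ++ v)) (ext 𝒯 (p ++ [t]))
    rw [dinf_comm (ext 𝒯 (p ++ [s])) (ext 𝒯 (p ++ [s] ++ u))] at t1
    rw [dinf_comm (ext 𝒯 (p ++ [s] ++ u)) x] at t2
    rw [dinf_comm x w] at t3
    omega

/-- Counting lemma. -/
theorem count {d L N n : ℕ} (M : ℕ) (hM : M ≤ N) (𝒯 : TN N → Site d) (x : Fin n → Site d)
    (hxinj : Function.Injective x) (a : Fin n → List (Fin 2)) (ha : ∀ i, (a i).length = N)
    (hx : ∀ i, dinf (x i) (ext 𝒯 (a i)) ≤ 2 * L) :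
    (Finset.univ.filter (fun p : Fin n × Fin n =>
      (a p.1).take (N - M) = (a p.2).take (N - M))).card ≤
      2 ^ N * 2 ^ M * (4 * L + 1) ^ (2 * d) := by
  classical
  let box : Finset (Site d) := Fintype.piFinset fun _ => Finset.Icc (-(2 * L : ℤ)) (2 * L)
  have hbox : box.card = (4 * L + 1) ^ d := by
    simp only [box, Fintype.card_piFinset_const, Int.card_Icc]
    congr 1
    omega
  have hmem : ∀ i, x i - ext 𝒯 (a i) ∈ box := by
    intro i
    simp only [box, Fintype.mem_piFinset, Finset.mem_Icc, Pi.sub_apply]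
    intro k
    have := (dinf_le_iff _ _ _).1 (hx i) k
    omega
  let S : Finset ((List.Vector (Fin 2) N × List.Vector (Fin 2) M) × (Site d × Site d)) :=
    (Finset.univ ×ˢ Finset.univ) ×ˢ (box ×ˢ box)
  have hS : S.card = 2 ^ N * 2 ^ M * (4 * L + 1) ^ (2 * d) := by
    simp only [S, Finset.card_product, Finset.card_univ, card_vector, hbox, Fintype.card_fin]
    ring
  rw [← hS]
  refine Finset.card_le_card_of_injOn (fun p => ((⟨a p.1, ha p.1⟩,
    ⟨(a p.2).drop (N - M), by simp [ha]; omega⟩),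
    (x p.1 - ext 𝒯 (a p.1), x p.2 - ext 𝒯 (a p.2)))) ?_ ?_
  · intro p _
    simp [S, hmem]
  · rintro ⟨i, j⟩ hp ⟨i', j'⟩ hq heq
    simp only [Finset.coe_filter, Finset.mem_univ, true_and, Set.mem_ofPred_eq] at hp hq
    have h1 : a i = a i' := congrArg (fun q => q.1.1.toList) heq
    have h2 : (a j).drop (N - M) = (a j').drop (N - M) := congrArg (fun q => q.1.2.toList) heq
    have h3 : x i - ext 𝒯 (a i) = x i' - ext 𝒯 (a i') := congrArg (fun q => q.2.1) heq
    have h4 : x j - ext 𝒯 (a j) = x j' - ext 𝒯 (a j') := congrArg (fun q => q.2.2) heq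
    have h5 : a j = a j' := by
      rw [← List.take_append_drop (N - M) (a j), ← List.take_append_drop (N - M) (a j'), h2,
        ← hp, ← hq, h1]
    rw [h1] at h3
    rw [h5] at h4
    have := hxinj (sub_left_injective h3)
    have := hxinj (sub_left_injective h4)
    simp [*]

theorem rpow_bound {ℓ d k D : ℕ} (hd : 3 ≤ d) (hℓ : 6 ≤ ℓ)
    (hD : (ℓ : ℝ) ^ ((1 : ℝ) / 4) * (ℓ : ℝ) ^ k ≤ D) :
    (D : ℝ) ^ ((2 : ℝ) - d) ≤ (ℓ : ℝ) ^ (((2 : ℝ) - d) / 4) * ((ℓ : ℝ) ^ ((2 : ℝ) - d)) ^ k := by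
  have hl : (0 : ℝ) < ℓ := by exact_mod_cast (by omega : 0 < ℓ)
  have hd' : (3 : ℝ) ≤ d := by exact_mod_cast hd
  calc (D : ℝ) ^ ((2 : ℝ) - d) ≤ ((ℓ : ℝ) ^ ((1 : ℝ) / 4) * (ℓ : ℝ) ^ k) ^ ((2 : ℝ) - d) :=
        Real.rpow_le_rpow_of_nonpos (by positivity) hD (by linarith)
    _ = _ := by
        rw [Real.mul_rpow (by positivity) (by positivity), ← Real.rpow_mul hl.le,
          ← Real.rpow_natCast, ← Real.rpow_natCast, ← Real.rpow_mul hl.le,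
          ← Real.rpow_mul hl.le]
        congr 2 <;> ring

theorem quarter_bound {ℓ k D : ℕ} (hℓ : 6 ≤ ℓ) (hD : ℓ ^ (k + 1) ≤ 2 * D) :
    (ℓ : ℝ) ^ ((1 : ℝ) / 4) * (ℓ : ℝ) ^ k ≤ D := by
  have hl : (6 : ℝ) ≤ ℓ := by exact_mod_cast hℓ
  have hD' : (ℓ : ℝ) ^ (k + 1) ≤ 2 * D := by exact_mod_cast hD
  obtain ⟨t, ht⟩ : ∃ t, t = (ℓ : ℝ) ^ ((1 : ℝ) / 4) := ⟨_, rfl⟩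
  have ht0 : 0 ≤ t := by rw [ht]; positivity
  have ht4 : t ^ 4 = ℓ := by
    rw [ht, ← Real.rpow_natCast, ← Real.rpow_mul (by positivity)]
    norm_num
  rw [← ht]
  have h2 : 2 * t ≤ ℓ := by
    by_contra hcon
    push Not at hcon
    have h3 : 3 < t := by linarith
    have h4 : 2 ≤ t ^ 3 := by
      have : (3 : ℝ) ^ 3 ≤ t ^ 3 := by gcongr
      linarith
    nlinarith
  have h5 : (0 : ℝ) ≤ (ℓ : ℝ) ^ k := by positivity
  rw [pow_succ] at hD'
  nlinarith

/-- Let `Λ` be the union of the leaf boxes of a proper embedding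
`𝒯 ∈ P_N` and let `Λ' ⊆ Λ` be enumerated by an injective family `x : Fin n → ℤ^d`.
Given points `w i` with `|w i − x i| ≤ ℓ/4` that are pairwise `ℓ^{1/4}`-separated, and a
kernel `h ≥ 0` with `h(u,v) ≤ c·|u−v|^{2−d}`, the product over (ordered) pairs `i < j` of
`1 + h(w i, w j)·(α̂⁻² − 1)` is at most
`exp{c·α̂⁻²·(4L+1)^{2d}·2^N·ℓ^{(2−d)/4}·(1 + 2·∑_{k≥0} (2ℓ^{2−d})^k)}`. -/
theorem product_pairs_bound (d L ℓ N : ℕ) (hd : 3 ≤ d) (hL : 3 ≤ L) (hℓ : 6 ≤ ℓ)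
    (hN : 1 ≤ N) (c : ℝ) (hc : 0 < c) (α : ℝ) (hα0 : 0 < α) (hα1 : α ≤ 1)
    (𝒯 : TN N → Site d) (h𝒯 : ProperEmbedding d L ℓ N 𝒯)
    (n : ℕ) (x : Fin n → Site d) (hxinj : Function.Injective x)
    (hxΛ : ∀ i, x i ∈ ⋃ m ∈ {m : TN N | IsLeaf m}, ball (𝒯 m) (2 * (L : ℤ)))
    (w : Fin n → Site d)
    (hwx : ∀ i, 4 * dinf (w i) (x i) ≤ ℓ)
    (hww : ∀ i j, i ≠ j → ((ℓ : ℝ) ^ ((1 : ℝ) / 4) ≤ (dinf (w i) (w j) : ℝ)))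
    (h : Site d → Site d → ℝ) (hh0 : ∀ u v, 0 ≤ h u v)
    (hhc : ∀ u v, u ≠ v → h u v ≤ c * (dinf u v : ℝ) ^ ((2 : ℝ) - d)) :
    ∏ p ∈ Finset.univ.filter (fun p : Fin n × Fin n => p.1 < p.2),
        (1 + h (w p.1) (w p.2) * (1 / α ^ 2 - 1)) ≤
      Real.exp (c * (1 / α ^ 2) * ((4 * L + 1 : ℕ) : ℝ) ^ (2 * d) * 2 ^ N *
        (ℓ : ℝ) ^ (((2 : ℝ) - d) / 4) *
        (1 + 2 * ∑' k : ℕ, (2 * (ℓ : ℝ) ^ ((2 : ℝ) - d)) ^ k)) := by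
  classical
  have hl6 : (6 : ℝ) ≤ ℓ := by exact_mod_cast hℓ
  have hd3 : (3 : ℝ) ≤ d := by exact_mod_cast hd
  have hleaf : ∀ i, ∃ a : List (Fin 2), a.length = N ∧ dinf (x i) (ext 𝒯 a) ≤ 2 * L := by
    intro i
    have hi := hxΛ i
    simp only [Set.mem_iUnion] at hi
    obtain ⟨m, hm, hb⟩ := hi
    have hm' : m.1.length = N := hm
    have hb' : ((dinf (x i) (𝒯 m) : ℕ) : ℤ) ≤ 2 * (L : ℤ) := hb
    refine ⟨m.1, hm', ?_⟩
    have : ext 𝒯 m.1 = 𝒯 m := by simp [ext, m.2]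
    rw [this]
    omega
  choose a ha hxa using hleaf
  obtain ⟨e, he⟩ : ∃ e, e = (ℓ : ℝ) ^ (((2 : ℝ) - d) / 4) := ⟨_, rfl⟩
  obtain ⟨ρ, hρ⟩ : ∃ ρ, ρ = (ℓ : ℝ) ^ ((2 : ℝ) - d) := ⟨_, rfl⟩
  have he0 : 0 ≤ e := by rw [he]; positivity
  have hρ0 : 0 ≤ ρ := by rw [hρ]; positivity
  have hρ1 : 2 * ρ < 1 := by
    have h1 : ρ ≤ (ℓ : ℝ) ^ (-1 : ℝ) := by
      rw [hρ]
      exact Real.rpow_le_rpow_of_exponent_le (by linarith) (by linarith)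
    rw [Real.rpow_neg_one] at h1
    have h2 : (ℓ : ℝ)⁻¹ ≤ (6 : ℝ)⁻¹ := inv_anti₀ (by norm_num) hl6
    norm_num at h2
    linarith
  rw [← he, ← hρ]
  let β : ℕ → ℝ := fun M => Nat.casesOn M e (fun k => e * ρ ^ k)
  have hβ0 : ∀ M, 0 ≤ β M := by
    intro M
    cases M with
    | zero => exact he0
    | succ k => exact mul_nonneg he0 (pow_nonneg hρ0 k)
  let S : Fin n × Fin n → ℝ := fun p => ∑ M ∈ Finset.range (N + 1),
    if (a p.1).take (N - M) = (a p.2).take (N - M) then β M else 0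
  have hS0 : ∀ p, 0 ≤ S p := fun p => Finset.sum_nonneg fun M _ => by
    split_ifs
    · exact hβ0 M
    · exact le_rfl
  have hSM : ∀ p M, M ≤ N → (a p.1).take (N - M) = (a p.2).take (N - M) → β M ≤ S p := by
    intro p M hM hp
    have := Finset.single_le_sum (s := Finset.range (N + 1))
      (f := fun M => if (a p.1).take (N - M) = (a p.2).take (N - M) then β M else 0)
      (fun M _ => by
        split_ifs
        · exact hβ0 M
        · exact le_rfl) (Finset.mem_range.2 (Nat.lt_succ_of_le hM))
    simpa only [hp, if_true] using this
  have hbase : ∀ i j, i ≠ j → (dinf (w i) (w j) : ℝ) ^ ((2 : ℝ) - d) ≤ e := by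
    intro i j hij
    have := rpow_bound (k := 0) hd hℓ (by simpa using hww i j hij)
    simpa [← he] using this
  have hpt : ∀ i j, i ≠ j → h (w i) (w j) ≤ c * S (i, j) := by
    intro i j hij
    have hne : w i ≠ w j := by
      intro hw
      have := hww i j hij
      rw [hw, dinf_self] at this
      have : (0 : ℝ) < (ℓ : ℝ) ^ ((1 : ℝ) / 4) := by positivity
      simp only [Nat.cast_zero] at *
      linarith
    refine (hhc _ _ hne).trans (mul_le_mul_of_nonneg_left ?_ hc.le)
    by_cases hab : a i = a j
    · exact (hbase i j hij).trans (hSM (i, j) 0 (by omega) (by simp [hab]))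
    · obtain ⟨M, hM1, hMN, htake, hD⟩ := geom hL hℓ h𝒯 (a i) (a j) (ha i) (ha j) hab
        (x i) (x j) (w i) (w j) (hxa i) (hxa j) (hwx i) (hwx j)
      refine le_trans ?_ (hSM (i, j) M hMN htake)
      obtain ⟨k, rfl⟩ : ∃ k, M = k + 1 := ⟨M - 1, by omega⟩
      show _ ≤ e * ρ ^ k
      rcases Nat.eq_zero_or_pos k with rfl | hk
      · simpa using hbase i j hij
      · rw [he, hρ]
        exact rpow_bound hd hℓ (quarter_bound hℓ (hD (by omega)))
  have hα2 : 1 ≤ 1 / α ^ 2 := by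
    rw [le_div_iff₀ (by positivity)]
    nlinarith
  have hsum : ∑ p : Fin n × Fin n, S p ≤
      ((4 * L + 1 : ℕ) : ℝ) ^ (2 * d) * 2 ^ N * e * (1 + 2 * ∑' k : ℕ, (2 * ρ) ^ k) := by
    have hts : ∑ k ∈ Finset.range N, (2 * ρ) ^ k ≤ ∑' k : ℕ, (2 * ρ) ^ k :=
      (summable_geometric_of_lt_one (by positivity) hρ1).sum_le_tsum _
        (fun k _ => by positivity)
    calc ∑ p : Fin n × Fin n, S p
        = ∑ M ∈ Finset.range (N + 1), ((Finset.univ.filter (fun p : Fin n × Fin n =>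
            (a p.1).take (N - M) = (a p.2).take (N - M))).card : ℝ) * β M := by
          rw [Finset.sum_comm]
          refine Finset.sum_congr rfl fun M _ => ?_
          rw [← Finset.sum_filter, Finset.sum_const, nsmul_eq_mul]
      _ ≤ ∑ M ∈ Finset.range (N + 1),
            (2 ^ N * 2 ^ M * ((4 * L + 1 : ℕ) : ℝ) ^ (2 * d)) * β M := by
          refine Finset.sum_le_sum fun M hM => mul_le_mul_of_nonneg_right ?_ (hβ0 M)
          have := count M (by simpa [Nat.lt_succ_iff] using hM) 𝒯 x hxinj a ha hxa
          exact_mod_cast this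
      _ = ((4 * L + 1 : ℕ) : ℝ) ^ (2 * d) * 2 ^ N * e *
            (1 + 2 * ∑ k ∈ Finset.range N, (2 * ρ) ^ k) := by
          rw [Finset.sum_range_succ', mul_add, Finset.mul_sum, Finset.mul_sum, add_comm]
          have hb0 : β 0 = e := rfl
          have hb1 : ∀ k, β (k + 1) = e * ρ ^ k := fun k => rfl
          simp only [hb0, hb1]
          congr 1
          · ring
          · refine Finset.sum_congr rfl fun k _ => ?_
            rw [mul_pow]
            ring
      _ ≤ _ := by gcongr
  calc ∏ p ∈ Finset.univ.filter (fun p : Fin n × Fin n => p.1 < p.2),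
        (1 + h (w p.1) (w p.2) * (1 / α ^ 2 - 1))
      ≤ ∏ p ∈ Finset.univ.filter (fun p : Fin n × Fin n => p.1 < p.2),
        Real.exp (c * (1 / α ^ 2) * S p) := by
        refine Finset.prod_le_prod ?_ ?_
        · intro p _
          have := mul_nonneg (hh0 (w p.1) (w p.2)) (sub_nonneg.2 hα2)
          linarith
        · intro p hp
          have hlt : p.1 < p.2 := by simpa using hp
          have h1 := hpt p.1 p.2 hlt.ne
          have h2 : h (w p.1) (w p.2) * (1 / α ^ 2 - 1) ≤ c * S p * (1 / α ^ 2) :=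
            mul_le_mul h1 (by linarith) (by linarith) (mul_nonneg hc.le (hS0 p))
          have h3 := Real.add_one_le_exp (c * (1 / α ^ 2) * S p)
          linarith
    _ = Real.exp (∑ p ∈ Finset.univ.filter (fun p : Fin n × Fin n => p.1 < p.2),
          c * (1 / α ^ 2) * S p) := (Real.exp_sum _ _).symm
    _ ≤ _ := by
        refine Real.exp_le_exp.2 ?_
        rw [← Finset.mul_sum]
        have h4 : ∑ p ∈ Finset.univ.filter (fun p : Fin n × Fin n => p.1 < p.2), S p ≤
            ∑ p : Fin n × Fin n, S p :=
          Finset.sum_le_sum_of_subset_of_nonneg (Finset.filter_subset _ _)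
            (fun p _ _ => hS0 p)
        have h5 := mul_le_mul_of_nonneg_left (h4.trans hsum)
          (show 0 ≤ c * (1 / α ^ 2) by positivity)
        refine h5.trans (le_of_eq ?_)
        ring

end VoterPerc
end

section
/- Let d ≥ 1, M ≥ 1 an integer, and ξ ∈ {0,1}^{Z^d}. Define the coarse-grained configuration ξ̃ ∈ {0,1}^{Z^d} by ξ̃(x) = 1 if and only if the translated configuration y ↦ ξ(y + Mx) belongs to E_M. If ξ̃ ∈ Perc, then ξ ∈ Perc. -/
open MeasureTheory

namespace VoterPerc

/-- `ConnIn ξ S x y`: `x` and `y` are joined by a nearest-neighbour path of `ξ`-open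
sites staying in `S` (in particular `x` and `y` are open and lie in `S`). -/
def ConnIn {d : ℕ} (ξ : Config d) (S : Set (Site d)) (x y : Site d) : Prop :=
  ∃ (n : ℕ) (γ : ℕ → Site d), γ 0 = x ∧ γ n = y ∧
    (∀ i ≤ n, γ i ∈ S ∧ ξ (γ i) = true) ∧ (∀ i < n, d1 (γ i) (γ (i + 1)) = 1)

/-- The open cluster of `x` inside the box `B(M)`. -/
def ClusterOf (d M : ℕ) (ξ : Config d) (x : Site d) : Set (Site d) :=
  {y | ConnIn ξ (ball (0 : Site d) (M : ℤ)) x y}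

/-- The open cluster of `x` inside `B(M)` has ℓ∞-diameter at least `M`. -/
def BigCluster (d M : ℕ) (ξ : Config d) (x : Site d) : Prop :=
  ∃ u ∈ ClusterOf d M ξ x, ∃ v ∈ ClusterOf d M ξ x, M ≤ dinf u v

/-- The event `E_M`: inside `B(M)` there is a unique open cluster of diameter at least
`M`, and this cluster meets each of the `2d` faces of `B(M)`. -/
def EM (d M : ℕ) : Set (Config d) :=
  {ξ | (∃ x, BigCluster d M ξ x) ∧
    (∀ x y, BigCluster d M ξ x → BigCluster d M ξ y → y ∈ ClusterOf d M ξ x) ∧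
    (∀ x, BigCluster d M ξ x → ∀ i : Fin d,
      (∃ y ∈ ClusterOf d M ξ x, y i = (M : ℤ)) ∧
      (∃ y ∈ ClusterOf d M ξ x, y i = -(M : ℤ)))}

lemma d1_comm {d : ℕ} (x y : Site d) : d1 x y = d1 y x := by
  unfold d1
  refine Finset.sum_congr rfl fun i _ => ?_
  omega

lemma coord_le_d1 {d : ℕ} (x y : Site d) (i : Fin d) : (x i - y i).natAbs ≤ d1 x y := by
  unfold d1
  exact Finset.single_le_sum (f := fun i => (x i - y i).natAbs) (fun _ _ => Nat.zero_le _)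
    (Finset.mem_univ i)

lemma coord_le_dinf {d : ℕ} (x y : Site d) (i : Fin d) : (x i - y i).natAbs ≤ dinf x y := by
  unfold dinf
  exact Finset.le_sup (f := fun i => (x i - y i).natAbs) (Finset.mem_univ i)

lemma mem_ball_zero {d : ℕ} (M : ℕ) (x : Site d) :
    x ∈ ball (0 : Site d) (M : ℤ) ↔ ∀ i, (x i).natAbs ≤ M := by
  unfold ball dinf
  simp [Finset.sup_le_iff]

lemma exists_coord {d : ℕ} (x y : Site d) (h : d1 x y = 1) :
    ∃ i, (y i = x i + 1 ∨ x i = y i + 1) ∧ ∀ j, j ≠ i → x j = y j := by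
  have h0 : ∃ i, x i ≠ y i := by
    by_contra hc
    push Not at hc
    have : d1 x y = 0 := by simp [d1, hc]
    omega
  obtain ⟨i, hi⟩ := h0
  have hs : (x i - y i).natAbs + ∑ j ∈ Finset.univ.erase i, (x j - y j).natAbs = 1 := by
    rw [← h]
    exact Finset.add_sum_erase _ (fun j => (x j - y j).natAbs) (Finset.mem_univ i)
  refine ⟨i, by omega, fun j hj => ?_⟩
  have := Finset.single_le_sum (s := Finset.univ.erase i) (f := fun i => (x i - y i).natAbs)
    (fun _ _ => Nat.zero_le _) (Finset.mem_erase.2 ⟨hj, Finset.mem_univ j⟩)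
  omega

lemma ConnIn.symm {d : ℕ} {ξ : Config d} {S : Set (Site d)} {x y : Site d}
    (h : ConnIn ξ S x y) : ConnIn ξ S y x := by
  obtain ⟨n, γ, h0, hn, ho, hs⟩ := h
  refine ⟨n, fun j => γ (n - j), by simpa using hn, by simpa using h0,
    fun i _ => ho _ (by omega), fun i hi => ?_⟩
  have := hs (n - (i + 1)) (by omega)
  rw [show n - (i + 1) + 1 = n - i by omega, d1_comm] at this
  exact this

lemma ConnIn.trans {d : ℕ} {ξ : Config d} {S : Set (Site d)} {x y z : Site d}
    (h : ConnIn ξ S x y) (h' : ConnIn ξ S y z) : ConnIn ξ S x z := by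
  obtain ⟨n, γ, h0, hn, ho, hs⟩ := h
  obtain ⟨m, δ, k0, km, ko, ks⟩ := h'
  refine ⟨n + m, fun j => if j ≤ n then γ j else δ (j - n), by simpa using h0, ?_, ?_, ?_⟩
  · by_cases hm : m = 0
    · subst hm; simp; rw [hn, ← km, k0]
    · simp [hm, km]
  · intro i hi
    by_cases hin : i ≤ n
    · simpa [hin] using ho i hin
    · simpa [hin] using ko (i - n) (by omega)
  · intro i hi
    rcases lt_trichotomy i n with hin | hin | hin
    · simpa [hin.le, Nat.succ_le_of_lt hin] using hs i hin
    · subst hin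
      have := ks 0 (by omega)
      rw [k0, ← hn] at this
      simpa using this
    · have := ks (i - n) (by omega)
      rw [show i - n + 1 = i + 1 - n by omega] at this
      simpa [show ¬ i ≤ n by omega, show ¬ i + 1 ≤ n by omega] using this

/-- The graph of open sites. -/
def openGraph {d : ℕ} (ξ : Config d) : SimpleGraph (Site d) where
  Adj x y := d1 x y = 1 ∧ ξ x = true ∧ ξ y = true
  symm := ⟨fun x y h => ⟨by rw [d1_comm]; exact h.1, h.2.2, h.2.1⟩⟩
  loopless := ⟨fun x h => by
    have := h.1
    simp [d1] at this⟩

lemma reachable_of_path {d : ℕ} (ξ : Config d) (γ : ℕ → Site d) (n : ℕ)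
    (ho : ∀ i ≤ n, ξ (γ i) = true) (hs : ∀ i < n, d1 (γ i) (γ (i + 1)) = 1) :
    (openGraph ξ).Reachable (γ 0) (γ n) := by
  induction n with
  | zero => exact SimpleGraph.Reachable.refl _
  | succ n ih =>
    refine (ih (fun i hi => ho i (by omega)) (fun i hi => hs i (by omega))).trans ?_
    exact SimpleGraph.Adj.reachable ⟨hs n (by omega), ho n (by omega), ho (n + 1) le_rfl⟩

lemma d1_shift {d : ℕ} (x y z : Site d) :
    d1 (fun i => x i + z i) (fun i => y i + z i) = d1 x y := by
  unfold d1
  refine Finset.sum_congr rfl fun i _ => ?_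
  congr 1
  ring

/-- The shifted configuration. -/
def shiftBy {d : ℕ} (M : ℕ) (ξ : Config d) (x : Site d) : Config d :=
  fun y : Site d => ξ (fun i => y i + (M : ℤ) * x i)

lemma reachable_of_conn {d : ℕ} {M : ℕ} {ξ : Config d} {x : Site d} {S : Set (Site d)}
    {a b : Site d} (h : ConnIn (shiftBy M ξ x) S a b) :
    (openGraph ξ).Reachable (fun i => a i + (M : ℤ) * x i) (fun i => b i + (M : ℤ) * x i) := by
  obtain ⟨n, γ, h0, hn, ho, hs⟩ := h
  subst h0 hn
  refine reachable_of_path ξ (fun j i => γ j i + (M : ℤ) * x i) n (fun i hi => (ho i hi).2)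
    fun i hi => ?_
  rw [d1_shift (γ i) (γ (i + 1)) (fun i => (M : ℤ) * x i)]
  exact hs i hi

lemma step_plus {d M : ℕ} {ξ : Config d} {x x' : Site d} {i : Fin d}
    (hi : x' i = x i + 1) (hne : ∀ j, j ≠ i → x j = x' j)
    (hx : shiftBy M ξ x ∈ EM d M) (hx' : shiftBy M ξ x' ∈ EM d M)
    {r r' : Site d} (hr : BigCluster d M (shiftBy M ξ x) r)
    (hr' : BigCluster d M (shiftBy M ξ x') r') :
    (openGraph ξ).Reachable (fun i => r i + (M : ℤ) * x i) (fun i => r' i + (M : ℤ) * x' i) := by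
  obtain ⟨⟨yp, hyp, hypi⟩, ⟨ym, hym, hymi⟩⟩ := hx.2.2 r hr i
  have hr2 : ConnIn (shiftBy M ξ x) (ball (0 : Site d) (M : ℤ)) r ym := hym
  have hp : ConnIn (shiftBy M ξ x) (ball (0 : Site d) (M : ℤ)) ym yp := ConnIn.trans (ConnIn.symm hym) hyp
  obtain ⟨n, γ, h0, hn, ho, hs⟩ := hp
  obtain ⟨k, hkn, hk0, hkgt⟩ : ∃ k ≤ n, γ k i ≤ 0 ∧ ∀ j, k < j → j ≤ n → 0 < γ j i := by
    classical
    refine ⟨Nat.findGreatest (fun k => γ k i ≤ 0) n, Nat.findGreatest_le _, ?_, ?_⟩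
    · exact Nat.findGreatest_spec (P := fun k => γ k i ≤ 0) (Nat.zero_le n)
        (by rw [h0, hymi]; omega)
    · intro j hj hjn
      have := Nat.findGreatest_is_greatest hj hjn
      omega
  have hk : γ k i = 0 := by
    rcases hkn.eq_or_lt with h | h
    · subst h
      rw [hn, hypi] at hk0 ⊢
      omega
    · have h1 := hkgt (k + 1) (by omega) (by omega)
      have h2 := coord_le_d1 (γ k) (γ (k + 1)) i
      rw [hs k h] at h2
      omega
  -- the shifted piece of path
  let e : Site d := fun j => (M : ℤ) * x j - (M : ℤ) * x' j
  have hei : e i = -(M : ℤ) := by simp only [e, hi]; ring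
  have hej : ∀ j, j ≠ i → e j = 0 := fun j hj => by simp only [e, hne j hj]; ring
  have hbase : ∀ j, (fun l => (γ j l + e l) + (M : ℤ) * x' l) = fun l => γ j l + (M : ℤ) * x l := by
    intro j
    funext l
    simp only [e]
    ring
  have hsub : ConnIn (shiftBy M ξ x') (ball (0 : Site d) (M : ℤ)) (fun l => γ k l + e l)
      (fun l => γ n l + e l) := by
    refine ⟨n - k, fun j l => γ (k + j) l + e l, rfl, ?_, ?_, ?_⟩
    · simp only [show k + (n - k) = n by omega]
    · intro j hj
      obtain ⟨hb, hop⟩ := ho (k + j) (by omega)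
      refine ⟨?_, ?_⟩
      · rw [mem_ball_zero] at hb ⊢
        intro l
        have hbl := hb l
        by_cases hl : l = i
        · subst hl
          have hge : 0 ≤ γ (k + j) l := by
            rcases Nat.eq_zero_or_pos j with h | h
            · subst h; simp [hk]
            · exact (hkgt (k + j) (by omega) (by omega)).le
          simp only [hei]
          omega
        · simp only [hej l hl]
          simpa using hbl
      · unfold shiftBy at hop ⊢
        rw [hbase]
        exact hop
    · intro j hj
      rw [d1_shift]
      exact hs (k + j) (by omega)
  have hself : ConnIn (shiftBy M ξ x') (ball (0 : Site d) (M : ℤ)) (fun l => γ k l + e l)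
      (fun l => γ k l + e l) := hsub.trans hsub.symm
  have hbig : BigCluster d M (shiftBy M ξ x') (fun l => γ k l + e l) := by
    refine ⟨_, hself, _, hsub, ?_⟩
    refine le_trans ?_ (coord_le_dinf _ _ i)
    simp only [hk, hn, hypi]
    omega
  have hc : ConnIn (shiftBy M ξ x') (ball (0 : Site d) (M : ℤ)) r' (fun l => γ k l + e l) :=
    hx'.2.1 _ _ hr' hbig
  have hc1 := reachable_of_conn hc
  rw [hbase] at hc1
  have hc2 : ConnIn (shiftBy M ξ x) (ball (0 : Site d) (M : ℤ)) ym (γ k) :=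
    ⟨k, γ, h0, rfl, fun j hj => ho j (by omega), fun j hj => hs j (by omega)⟩
  exact (reachable_of_conn (hr2.trans hc2)).trans hc1.symm

lemma step_any {d M : ℕ} {ξ : Config d} {x x' : Site d} (h : d1 x x' = 1)
    (hx : shiftBy M ξ x ∈ EM d M) (hx' : shiftBy M ξ x' ∈ EM d M)
    {r r' : Site d} (hr : BigCluster d M (shiftBy M ξ x) r)
    (hr' : BigCluster d M (shiftBy M ξ x') r') :
    (openGraph ξ).Reachable (fun i => r i + (M : ℤ) * x i) (fun i => r' i + (M : ℤ) * x' i) := by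
  obtain ⟨i, hi | hi, hne⟩ := exists_coord x x' h
  · exact step_plus hi hne hx hx' hr hr'
  · exact (step_plus hi (fun j hj => (hne j hj).symm) hx' hx hr' hr).symm

lemma finite_nbrs {d : ℕ} (x : Site d) : {y : Site d | d1 x y = 1}.Finite := by
  refine (Set.finite_Icc (fun i => x i - 1) (fun i => x i + 1)).subset fun y hy => ?_
  have hy' : d1 x y = 1 := hy
  refine ⟨fun i => ?_, fun i => ?_⟩ <;>
  · have := coord_le_d1 x y i
    simp only
    omega

/-- Koenig's lemma for locally finite graphs. -/
lemma konig {V : Type*} (G : SimpleGraph V) (hfin : ∀ v, {w | G.Adj v w}.Finite) (o : V)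
    (hinf : {w | G.Reachable o w}.Infinite) :
    ∃ γ : ℕ → V, Function.Injective γ ∧ ∀ n, G.Adj (γ n) (γ (n + 1)) := by
  let S : V → Set V := fun v =>
    {w | G.Reachable v w ∧ G.dist o w = G.dist o v + G.dist v w}
  let P : V → Prop := fun v => G.Reachable o v ∧ (S v).Infinite
  have hstep : ∀ v, P v → ∃ v', G.Adj v v' ∧ G.dist o v' = G.dist o v + 1 ∧ P v' := by
    rintro v ⟨hov, hSv⟩
    have hcov : S v \ {v} ⊆ ⋃ v' ∈ {w | G.Adj v w},
        {w | w ∈ S v' ∧ G.dist o v' = G.dist o v + 1} := by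
      rintro w ⟨⟨hvw, hd⟩, hne⟩
      obtain ⟨p, hp⟩ := hvw.exists_walk_length_eq_dist
      cases p with
      | nil => exact absurd rfl hne
      | @cons _ v' _ hadj q =>
        simp only [SimpleGraph.Walk.length_cons] at hp
        have h1 : G.dist v' w ≤ q.length := SimpleGraph.dist_le q
        obtain ⟨a, ha⟩ := hov.exists_walk_length_eq_dist
        have h2 : G.dist o v' ≤ G.dist o v + 1 := by
          have := SimpleGraph.dist_le (a.concat hadj)
          rw [SimpleGraph.Walk.length_concat, ha] at this
          exact this
        obtain ⟨b, hb⟩ := (hov.trans hadj.reachable).exists_walk_length_eq_dist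
        obtain ⟨c, hc⟩ := q.reachable.exists_walk_length_eq_dist
        have h3 : G.dist o w ≤ G.dist o v' + G.dist v' w := by
          have := SimpleGraph.dist_le (b.append c)
          rw [SimpleGraph.Walk.length_append, hb, hc] at this
          exact this
        simp only [Set.mem_iUnion]
        exact ⟨v', hadj, ⟨q.reachable, by omega⟩, by omega⟩
    have hI : (S v \ {v}).Infinite := hSv.sdiff (Set.finite_singleton v)
    by_contra hno
    push Not at hno
    refine hI (((hfin v).biUnion fun v' hv' => ?_).subset hcov)
    by_cases hd : G.dist o v' = G.dist o v + 1
    · have := hno v' hv' hd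
      have hnf : ¬ (S v').Infinite := fun h =>
        this ⟨hov.trans (SimpleGraph.Adj.reachable hv'), h⟩
      exact (Set.not_infinite.1 hnf).subset fun w hw => hw.1
    · refine Set.finite_empty.subset fun w hw => absurd hw.2 hd
  choose! f hf using hstep
  have hPo : P o := by
    refine ⟨SimpleGraph.Reachable.refl _, ?_⟩
    have : S o = {w | G.Reachable o w} := by
      ext w
      simp [S]
    rw [this]
    exact hinf
  let γ : ℕ → V := fun n => f^[n] o
  have hγs : ∀ n, γ (n + 1) = f (γ n) := fun n => Function.iterate_succ_apply' f n o
  have hγP : ∀ n, P (γ n) := by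
    intro n
    induction n with
    | zero => exact hPo
    | succ n ih => rw [hγs]; exact (hf _ ih).2.2
  have hγd : ∀ n, G.dist o (γ n) = n := by
    intro n
    induction n with
    | zero => simp [γ]
    | succ n ih => rw [hγs, (hf _ (hγP n)).2.1, ih]
  refine ⟨γ, fun a b hab => ?_, fun n => ?_⟩
  · rw [← hγd a, ← hγd b, hab]
  · rw [hγs]; exact (hf _ (hγP n)).1

/-- If the coarse-grained configuration
`ξ̃(x) = 1 ↔ (y ↦ ξ(y + Mx)) ∈ E_M` percolates, then `ξ` percolates. -/
theorem coarse_grained_percolation (d M : ℕ) (hd : 1 ≤ d) (hM : 1 ≤ M)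
    (ξ ξt : Config d)
    (hξt : ∀ x : Site d,
      ξt x = true ↔ (fun y : Site d => ξ (fun i => y i + (M : ℤ) * x i)) ∈ EM d M)
    (hperc : ξt ∈ Perc d) : ξ ∈ Perc d := by
  obtain ⟨γ, hinj, hadj, hopen⟩ := hperc
  have hE : ∀ n, shiftBy M ξ (γ n) ∈ EM d M := fun n => (hξt (γ n)).1 (hopen n)
  have hroot : ∀ n, ∃ r, BigCluster d M (shiftBy M ξ (γ n)) r := fun n => (hE n).1
  choose r hr using hroot
  let p : ℕ → Site d := fun n i => r n i + (M : ℤ) * γ n i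
  have hreach : ∀ n, (openGraph ξ).Reachable (p 0) (p n) := by
    intro n
    induction n with
    | zero => exact SimpleGraph.Reachable.refl _
    | succ n ih =>
      exact ih.trans (step_any (hadj n) (hE n) (hE (n + 1)) (hr n) (hr (n + 1)))
  have hball : ∀ n i, (r n i).natAbs ≤ M := by
    intro n
    obtain ⟨u, ⟨m, δ, h0, _, ho, _⟩, _⟩ := hr n
    have := (ho 0 (Nat.zero_le _)).1
    rw [h0, mem_ball_zero] at this
    exact this
  have hpinf : (Set.range p).Infinite := by
    intro hfin
    have hbig : (⋃ q ∈ Set.range p,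
        Set.Icc (fun i => -|q i| - (M : ℤ) : Site d) (fun i => |q i| + (M : ℤ))).Finite :=
      hfin.biUnion fun q _ => Set.finite_Icc _ _
    refine Set.infinite_range_of_injective hinj (hbig.subset ?_)
    rintro _ ⟨n, rfl⟩
    simp only [Set.mem_iUnion]
    have key : ∀ i, |γ n i| ≤ |p n i| + M := by
      intro i
      have h1 : |r n i| ≤ M := by
        have := hball n i
        rw [abs_le]; omega
      have h2 : |(M : ℤ) * γ n i| ≤ |p n i| + |r n i| := by
        have : (M : ℤ) * γ n i = p n i - r n i := by simp only [p]; ring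
        rw [this]
        exact abs_sub _ _
      rw [abs_mul, Nat.abs_cast] at h2
      have hM' : (1 : ℤ) ≤ M := by exact_mod_cast hM
      nlinarith [abs_nonneg (γ n i)]
    refine ⟨p n, ⟨n, rfl⟩, fun i => ?_, fun i => ?_⟩
    · have := abs_le.1 (key i)
      simp only
      linarith [this.1]
    · exact (abs_le.1 (key i)).2
  have hinf : {w | (openGraph ξ).Reachable (p 0) w}.Infinite := by
    refine hpinf.mono ?_
    rintro _ ⟨n, rfl⟩
    exact hreach n
  obtain ⟨δ, hδi, hδ⟩ := konig (openGraph ξ)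
    (fun v => (finite_nbrs v).subset fun w hw => hw.1) (p 0) hinf
  exact ⟨δ, hδi, fun n => (hδ n).1, fun n => (hδ n).2.1⟩

end VoterPerc
end
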